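/- Let 0 < m < n. Fix an observed table (n11, n10, n01, n00) with n11 + n10 = m and total sum n, a level α ∈ (0,1), and the rational threshold t = n11/m − n01/(n − m). Let A1 = {N10 − N01 : N = (N11, N10, N01, N00) is a potential table compatible with the observed table and p1(N) ≥ α} ⊆ ℤ. Then A1 is upward closed up to n11 + n00: if k ∈ A1 and k' is an integer with k ≤ k' ≤ n11 + n00, then k' ∈ A1. -/

import Mathlib

open Finset

/-- Number of treated units with outcome 1: `n11(S) = #{j ∈ S : y1 j = 1}`. -/
def nObs11 {n : ℕ} (y1 : Fin n → Bool) (S : Finset (Fin n)) : ℕ :=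
  (S.filter (fun j => y1 j = true)).card

/-- Number of treated units with outcome 0: `n10(S) = #{j ∈ S : y1 j = 0}`. -/
def nObs10 {n : ℕ} (y1 : Fin n → Bool) (S : Finset (Fin n)) : ℕ :=
  (S.filter (fun j => y1 j = false)).card

/-- Number of control units with outcome 1: `n01(S) = #{j ∉ S : y0 j = 1}`. -/
def nObs01 {n : ℕ} (y0 : Fin n → Bool) (S : Finset (Fin n)) : ℕ :=
  (Sᶜ.filter (fun j => y0 j = true)).card

/-- Number of control units with outcome 0: `n00(S) = #{j ∉ S : y0 j = 0}`. -/
def nObs00 {n : ℕ} (y0 : Fin n → Bool) (S : Finset (Fin n)) : ℕ :=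
  (Sᶜ.filter (fun j => y0 j = false)).card

/-- The potential table `(N11, N10, N01, N00)` of potential outcomes `(y1, y0)`. -/
def potTable {n : ℕ} (y1 y0 : Fin n → Bool) : ℕ × ℕ × ℕ × ℕ :=
  ((univ.filter (fun j => y1 j = true ∧ y0 j = true)).card,
   (univ.filter (fun j => y1 j = true ∧ y0 j = false)).card,
   (univ.filter (fun j => y1 j = false ∧ y0 j = true)).card,
   (univ.filter (fun j => y1 j = false ∧ y0 j = false)).card)

/-- The observed table `(n11(S), n10(S), n01(S), n00(S))`. -/
def obsTable {n : ℕ} (y1 y0 : Fin n → Bool) (S : Finset (Fin n)) : ℕ × ℕ × ℕ × ℕ :=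
  (nObs11 y1 S, nObs10 y1 S, nObs01 y0 S, nObs00 y0 S)

/-- The estimator `τ̂(S) = n11(S)/m - n01(S)/(n - m)`. -/
def tauHat {n : ℕ} (m : ℕ) (y1 y0 : Fin n → Bool) (S : Finset (Fin n)) : ℚ :=
  (nObs11 y1 S : ℚ) / m - (nObs01 y0 S : ℚ) / ((n : ℚ) - m)

/-- The average causal effect `τ = (N10 - N01)/n` of potential outcomes `(y1, y0)`. -/
def tauPO {n : ℕ} (y1 y0 : Fin n → Bool) : ℚ :=
  (((potTable y1 y0).2.1 : ℚ) - ((potTable y1 y0).2.2.1 : ℚ)) / n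

/-- One-sided p-value at threshold `t`:
`#{S : |S| = m, τ̂(S) ≥ t} / C(n, m)`. -/
def pOne {n : ℕ} (m : ℕ) (t : ℚ) (y1 y0 : Fin n → Bool) : ℚ :=
  ((((univ : Finset (Fin n)).powersetCard m).filter
      (fun S => t ≤ tauHat m y1 y0 S)).card : ℚ) / (n.choose m)

/-- Two-sided p-value at threshold `t`:
`#{S : |S| = m, |τ̂(S) - τ| ≥ |t - τ|} / C(n, m)` where `τ` is the average causal
effect of `(y1, y0)`. -/
def pTwo {n : ℕ} (m : ℕ) (t : ℚ) (y1 y0 : Fin n → Bool) : ℚ :=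
  ((((univ : Finset (Fin n)).powersetCard m).filter
      (fun S => |t - tauPO y1 y0| ≤ |tauHat m y1 y0 S - tauPO y1 y0|)).card : ℚ) / (n.choose m)

/-- Canonical treatment potential outcomes realizing a table: first `N11 + N10` units
have `y1 = 1`. -/
def canY1 (n N11 N10 : ℕ) : Fin n → Bool :=
  fun j => decide (j.val < N11 + N10)

/-- Canonical control potential outcomes realizing a table: first `N11` units and the
`N01` units following the first `N11 + N10` ones have `y0 = 1`. -/
def canY0 (n N11 N10 N01 : ℕ) : Fin n → Bool :=
  fun j => decide (j.val < N11 ∨ (N11 + N10 ≤ j.val ∧ j.val < N11 + N10 + N01))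

/-- One-sided p-value of a potential table `N = (N11, N10, N01, N00)`, well defined
since the p-value depends on the potential outcomes only through the table. -/
def pOneTable (n m : ℕ) (t : ℚ) (N11 N10 N01 N00 : ℕ) : ℚ :=
  pOne m t (canY1 n N11 N10) (canY0 n N11 N10 N01)

/-- Two-sided p-value of a potential table `N = (N11, N10, N01, N00)`:
`#{S : |S| = m, |τ̂(S) - τ(N)| ≥ |t - τ(N)|} / C(n, m)` with `τ(N) = (N10 - N01)/n`,
well defined since it depends on the potential outcomes only through the table. -/
def pTwoTable (n m : ℕ) (t : ℚ) (N11 N10 N01 N00 : ℕ) : ℚ :=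
  ((((univ : Finset (Fin n)).powersetCard m).filter
      (fun S => |t - ((N10 : ℚ) - N01) / n| ≤
        |tauHat m (canY1 n N11 N10) (canY0 n N11 N10 N01) S - ((N10 : ℚ) - N01) / n|)).card : ℚ)
    / (n.choose m)

/-- A potential table `N` is compatible with an observed table `obs` if some potential
outcomes with table `N` produce `obs` under some assignment of `m` units to treatment. -/
def Compatible (n m : ℕ) (N obs : ℕ × ℕ × ℕ × ℕ) : Prop :=
  ∃ (y1 y0 : Fin n → Bool) (S : Finset (Fin n)),
    S.card = m ∧ potTable y1 y0 = N ∧ obsTable y1 y0 S = obs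


theorem potTable_sub_eq_sum {n : ℕ} (y1 y0 : Fin n → Bool) :
    ((potTable y1 y0).2.1 : ℤ) - (potTable y1 y0).2.2.1 =
      ∑ j, (((y1 j).toNat : ℤ) - (y0 j).toNat) := by
  simp only [potTable, Finset.card_filter, Nat.cast_sum, ← Finset.sum_sub_distrib]
  refine Finset.sum_congr rfl fun j _ => ?_
  cases y1 j <;> cases y0 j <;> simp

theorem nObs11_add_nObs00_eq_sum {n : ℕ} (y1 y0 : Fin n → Bool) (S : Finset (Fin n)) :
    (nObs11 y1 S : ℤ) + nObs00 y0 S =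
      ∑ j, if j ∈ S then ((y1 j).toNat : ℤ) else 1 - (y0 j).toNat := by
  have h11 : S.filter (fun j => y1 j = true) = univ.filter (fun j => j ∈ S ∧ y1 j = true) := by
    ext; simp
  have h00 : Sᶜ.filter (fun j => y0 j = false) = univ.filter (fun j => j ∉ S ∧ y0 j = false) := by
    ext; simp
  rw [nObs11, nObs00, h11, h00]
  simp only [Finset.card_filter, Nat.cast_sum, ← Finset.sum_add_distrib]
  refine Finset.sum_congr rfl fun j _ => ?_
  by_cases hj : j ∈ S <;> cases y1 j <;> cases y0 j <;> simp [hj]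

theorem obsTable_congr {n : ℕ} {y1 y0 z1 z0 : Fin n → Bool} {S : Finset (Fin n)}
    (h1 : ∀ j ∈ S, y1 j = z1 j) (h0 : ∀ j ∉ S, y0 j = z0 j) :
    obsTable y1 y0 S = obsTable z1 z0 S := by
  have h0' : ∀ j ∈ Sᶜ, y0 j = z0 j := fun j hj => h0 j (Finset.mem_compl.mp hj)
  simp only [obsTable, nObs11, nObs10, nObs01, nObs00, Prod.mk.injEq]
  refine ⟨?_, ?_, ?_, ?_⟩ <;> congr 1 <;> refine Finset.filter_congr fun j hj => ?_
  · rw [h1 j hj]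
  · rw [h1 j hj]
  · rw [h0' j hj]
  · rw [h0' j hj]

theorem tauHat_mono {n m : ℕ} (hmn : m ≤ n) {y1 y0 z1 z0 : Fin n → Bool}
    (h1 : y1 ≤ z1) (h0 : z0 ≤ y0) (S : Finset (Fin n)) :
    tauHat m y1 y0 S ≤ tauHat m z1 z0 S := by
  have hnm : (0 : ℚ) ≤ (n : ℚ) - m := sub_nonneg.mpr (by exact_mod_cast hmn)
  have h11 : nObs11 y1 S ≤ nObs11 z1 S :=
    Finset.card_le_card (Finset.monotone_filter_right S fun j _ hj => h1 j hj)
  have h01 : nObs01 z0 S ≤ nObs01 y0 S :=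
    Finset.card_le_card (Finset.monotone_filter_right Sᶜ fun j _ hj => h0 j hj)
  unfold tauHat
  gcongr

theorem pOne_mono {n m : ℕ} (hmn : m ≤ n) (t : ℚ) {y1 y0 z1 z0 : Fin n → Bool}
    (h1 : y1 ≤ z1) (h0 : z0 ≤ y0) : pOne m t y1 y0 ≤ pOne m t z1 z0 := by
  unfold pOne
  gcongr with S hS
  exact tauHat_mono hmn h1 h0 S

theorem tauHat_map_perm {n : ℕ} (m : ℕ) (y1 y0 : Fin n → Bool) (σ : Equiv.Perm (Fin n))
    (S : Finset (Fin n)) :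
    tauHat m y1 y0 (S.map σ.toEmbedding) = tauHat m (y1 ∘ σ) (y0 ∘ σ) S := by
  have hcompl : (S.map σ.toEmbedding)ᶜ = Sᶜ.map σ.toEmbedding := by
    ext j; simp [Finset.mem_map_equiv]
  simp only [tauHat, nObs11, nObs01, hcompl, Finset.filter_map, Finset.card_map]
  rfl

theorem pOne_comp_perm {n : ℕ} (m : ℕ) (t : ℚ) (y1 y0 : Fin n → Bool)
    (σ : Equiv.Perm (Fin n)) : pOne m t (y1 ∘ σ) (y0 ∘ σ) = pOne m t y1 y0 := by
  unfold pOne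
  congr 2
  refine Finset.card_equiv σ.finsetCongr fun S => ?_
  simp [Finset.mem_powersetCard, tauHat_map_perm]

theorem exists_perm_of_card_fiber_eq {ι κ : Type*} [Fintype ι] [DecidableEq κ] {f g : ι → κ}
    (h : ∀ c, (univ.filter (fun j => f j = c)).card = (univ.filter (fun j => g j = c)).card) :
    ∃ σ : Equiv.Perm ι, g ∘ σ = f := by
  have e : ∀ c, Nonempty ({j // f j = c} ≃ {j // g j = c}) := fun c =>
    ⟨Fintype.equivOfCardEq (by simpa only [Fintype.card_subtype] using h c)⟩
  exact ⟨Equiv.ofFiberEquiv fun c => (e c).some, funext fun j => Equiv.ofFiberEquiv_map _ j⟩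

theorem exists_perm_of_potTable_eq {n : ℕ} {y1 y0 z1 z0 : Fin n → Bool}
    (h : potTable y1 y0 = potTable z1 z0) :
    ∃ σ : Equiv.Perm (Fin n), z1 ∘ σ = y1 ∧ z0 ∘ σ = y0 := by
  simp only [potTable, Prod.mk.injEq] at h
  obtain ⟨h11, h10, h01, h00⟩ := h
  obtain ⟨σ, hσ⟩ := exists_perm_of_card_fiber_eq
    (f := fun j => (y1 j, y0 j)) (g := fun j => (z1 j, z0 j)) (by
      rintro ⟨_ | _, _ | _⟩ <;> simpa only [Prod.mk.injEq])
  exact ⟨σ, funext fun j => congrArg Prod.fst (congrFun hσ j),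
    funext fun j => congrArg Prod.snd (congrFun hσ j)⟩

theorem potTable_sum {n : ℕ} (y1 y0 : Fin n → Bool) :
    (potTable y1 y0).1 + (potTable y1 y0).2.1 + (potTable y1 y0).2.2.1 +
      (potTable y1 y0).2.2.2 = n := by
  simp only [potTable, Finset.card_filter, ← Finset.sum_add_distrib]
  rw [Finset.sum_congr rfl (g := fun _ => 1)
    (fun j _ => by cases y1 j <;> cases y0 j <;> simp)]
  simp

theorem card_filter_fin_Ico {n a b : ℕ} (hb : b ≤ n) (P : Fin n → Prop) [DecidablePred P]
    (hP : ∀ j, P j ↔ a ≤ j.val ∧ j.val < b) : (univ.filter P).card = b - a := by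
  rw [← Nat.card_Ico, ← Finset.card_map Fin.valEmbedding]
  congr 1
  ext i
  simp only [Finset.mem_map, Finset.mem_filter, Finset.mem_univ, true_and, hP,
    Fin.valEmbedding_apply, Finset.mem_Ico]
  exact ⟨fun ⟨j, hj, hji⟩ => hji ▸ hj, fun hi => ⟨⟨i, by omega⟩, hi, rfl⟩⟩

theorem potTable_canonical {n N11 N10 N01 N00 : ℕ} (h : N11 + N10 + N01 + N00 = n) :
    potTable (canY1 n N11 N10) (canY0 n N11 N10 N01) = (N11, N10, N01, N00) := by
  simp only [potTable, Prod.mk.injEq]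
  refine ⟨?_, ?_, ?_, ?_⟩
  · exact (card_filter_fin_Ico (a := 0) (b := N11) (by omega) _ fun j => by
      simp [canY1, canY0]; omega).trans (by omega)
  · exact (card_filter_fin_Ico (a := N11) (b := N11 + N10) (by omega) _ fun j => by
      simp [canY1, canY0]; omega).trans (by omega)
  · exact (card_filter_fin_Ico (a := N11 + N10) (b := N11 + N10 + N01) (by omega) _ fun j => by
      simp [canY1, canY0]; omega).trans (by omega)
  · exact (card_filter_fin_Ico (a := N11 + N10 + N01) (b := n) (by omega) _ fun j => by
      have := j.isLt; simp [canY1, canY0]; omega).trans (by omega)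

theorem pOneTable_potTable {n : ℕ} (m : ℕ) (t : ℚ) {y1 y0 : Fin n → Bool}
    {N11 N10 N01 N00 : ℕ} (h : potTable y1 y0 = (N11, N10, N01, N00)) :
    pOneTable n m t N11 N10 N01 N00 = pOne m t y1 y0 := by
  have hsum := potTable_sum y1 y0
  rw [h] at hsum
  obtain ⟨σ, h1, h0⟩ := exists_perm_of_potTable_eq (h.trans (potTable_canonical hsum).symm)
  rw [pOneTable, ← h1, ← h0, pOne_comp_perm]

theorem sum_toNat_update_left {ι : Type*} [Fintype ι] [DecidableEq ι] {y : ι → Bool} {j : ι}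
    (hj : y j = false) :
    ∑ i, ((Function.update y j true i).toNat : ℤ) = ∑ i, ((y i).toNat : ℤ) + 1 := by
  rw [← Finset.add_sum_erase _ _ (Finset.mem_univ j),
    ← Finset.add_sum_erase univ (fun i => ((y i).toNat : ℤ)) (Finset.mem_univ j),
    Finset.sum_congr rfl fun i hi => by
      rw [Function.update_of_ne (Finset.ne_of_mem_erase hi)]]
  simp [hj, add_comm]

/-- Unless the unobserved outcomes are already the most favourable ones, one of them can be
changed so that the total effect grows by one. -/
theorem exists_increment {n : ℕ} {y1 y0 : Fin n → Bool} {S : Finset (Fin n)}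
    (h : ((potTable y1 y0).2.1 : ℤ) - (potTable y1 y0).2.2.1 <
      (nObs11 y1 S : ℤ) + nObs00 y0 S) :
    ∃ z1 z0 : Fin n → Bool, y1 ≤ z1 ∧ z0 ≤ y0 ∧ obsTable z1 z0 S = obsTable y1 y0 S ∧
      ((potTable z1 z0).2.1 : ℤ) - (potTable z1 z0).2.2.1 =
        (potTable y1 y0).2.1 - (potTable y1 y0).2.2.1 + 1 := by
  rw [potTable_sub_eq_sum, nObs11_add_nObs00_eq_sum] at h
  obtain ⟨j, -, hj⟩ := Finset.exists_lt_of_sum_lt h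
  by_cases hjS : j ∈ S
  · have hy : y0 j = true := by
      cases hy : y0 j <;> simp_all
    refine ⟨y1, Function.update y0 j false, le_rfl,
      update_le_self_iff.mpr (Bool.false_le _),
      obsTable_congr (fun _ _ => rfl) fun i hi => Function.update_of_ne (by grind) _ _, ?_⟩
    have := sum_toNat_update_left (y := Function.update y0 j false) (j := j) (by simp)
    rw [Function.update_idem, ← hy, Function.update_eq_self] at this
    simp only [potTable_sub_eq_sum, Finset.sum_sub_distrib]
    omega
  · have hy : y1 j = false := by
      cases hy : y1 j <;> simp_all
    refine ⟨Function.update y1 j true, y0, le_update_self_iff.mpr (Bool.le_true _),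
      le_rfl,
      obsTable_congr (fun i hi => Function.update_of_ne (by grind) _ _) fun _ _ => rfl, ?_⟩
    have := sum_toNat_update_left hy
    simp only [potTable_sub_eq_sum, Finset.sum_sub_distrib]
    omega

/-- Theorem A.5: the set of values `N10 - N01` over potential
tables compatible with the observed table with `p1(N) ≥ α` is upward closed up to
`n11 + n00`. -/
theorem oneSided_confidence_set_upward_closed (n m : ℕ) (hm : 0 < m) (hmn : m < n)
    (n11 n10 n01 n00 : ℕ) (hobs1 : n11 + n10 = m) (hobs2 : n11 + n10 + n01 + n00 = n)
    (α : ℚ) (hα : 0 < α ∧ α < 1)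
    (t : ℚ) (ht : t = (n11 : ℚ) / m - (n01 : ℚ) / ((n : ℚ) - m))
    (A1 : Set ℤ)
    (hA1 : A1 = {k : ℤ | ∃ N11 N10 N01 N00 : ℕ,
      Compatible n m (N11, N10, N01, N00) (n11, n10, n01, n00) ∧
      α ≤ pOneTable n m t N11 N10 N01 N00 ∧ (N10 : ℤ) - N01 = k})
    (k k' : ℤ) (hk : k ∈ A1) (hle1 : k ≤ k') (hle2 : k' ≤ (n11 : ℤ) + n00) :
    k' ∈ A1 := by
  subst hA1
  induction k', hle1 using Int.leInduction with
  | base => exact hk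
  | succ k' _ ih =>
    obtain ⟨N11, N10, N01, N00, ⟨y1, y0, S, hS, hN, hobs⟩, hα', rfl⟩ := ih (by omega)
    rw [pOneTable_potTable m t hN] at hα'
    have hlt : ((potTable y1 y0).2.1 : ℤ) - (potTable y1 y0).2.2.1 <
        (nObs11 y1 S : ℤ) + nObs00 y0 S := by
      simp only [obsTable, Prod.mk.injEq] at hobs
      rw [hN, hobs.1, hobs.2.2.2]
      dsimp only
      omega
    obtain ⟨z1, z0, h1, h0, hz, heff⟩ := exists_increment hlt
    rw [hN] at heff
    refine ⟨_, _, _, _, ⟨z1, z0, S, hS, rfl, hz.trans hobs⟩, ?_, heff⟩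
    rw [pOneTable_potTable m t (y1 := z1) (y0 := z0) rfl]
    exact hα'.trans (pOne_mono hmn.le t h1 h0)
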